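/- Let d be an admissible sequence and b an admissible family. Then for every real s > 0 the series F₃(s) = Σ_{n∈ℤ} Σ_{m≥0} c^{2n+m} q^{n-m/2} d_m b(n,m) · Σ_{l≥l₁} (c^{-1}α^{-1})^l q^{l/2} (q^{s(|n+m-l|+|n-l|)} - q^{s(|n+m|+|n|)}) converges absolutely, and lim_{s→0⁺} s·F₃(s) = 0. -/

import Mathlib

open Filter Topology

noncomputable section

/-- `qc q x` is the real power `q ^ x`, viewed as a complex number. -/
def qc (q : ℝ) (x : ℝ) : ℂ := ((q ^ x : ℝ) : ℂ)

/-- An admissible sequence: `d m = q^(m/2) (c₁ c^m + c₂ c^(-m))` for all `m ≥ l₁`. -/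
def IsAdmissibleSeq (q : ℝ) (c : ℂ) (l₁ : ℤ) (d : ℕ → ℂ) : Prop :=
  ∃ c₁ c₂ : ℂ, ∀ m : ℕ, l₁ ≤ (m : ℤ) →
    d m = qc q ((m : ℝ) / 2) * (c₁ * c ^ (m : ℤ) + c₂ * c ^ (-(m : ℤ)))

/-- An admissible family on `ℤ × ℕ`, given by region asymptotics. -/
def IsAdmissibleFam (q : ℝ) (l₁ : ℤ) (a : ℤ → ℕ → ℂ) : Prop :=
  ∃ (k₁ k₂ k₃ : ℂ) (A B : ℤ → ℂ), ∀ (n : ℤ) (m : ℕ),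
    (l₁ ≤ n → a n m = k₁) ∧
    (-l₁ < n → n < l₁ → l₁ ≤ n + (m : ℤ) → a n m = A n) ∧
    (n ≤ -l₁ → l₁ ≤ n + (m : ℤ) → a n m = qc q (-(n : ℝ)) * k₂) ∧
    (n ≤ -l₁ → -l₁ < n + (m : ℤ) → n + (m : ℤ) < l₁ →
      a n m = qc q (-(n : ℝ)) * B (n + m)) ∧
    (n + (m : ℤ) ≤ -l₁ → a n m = qc q (-(2 * (n : ℝ) + (m : ℝ))) * k₃)

/-- An `l`-stabilized family on `ℤ × ℕ` (the regions do not depend on `l`). -/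
def IsStabilizedFam (q : ℝ) (c : ℂ) (l₁ : ℤ) (e : ℤ → ℕ → ℂ) : Prop :=
  ∃ (u w : ℂ) (f v : ℤ → ℂ) (N : ℤ), 2 * l₁ < N ∧ ∀ (n : ℤ) (m : ℕ),
    (l₁ ≤ n → e n m = (c ^ 2 * (q : ℂ)) ^ n * (c * qc q (1 / 2)) ^ m * u) ∧
    (-l₁ < n → n < l₁ → N ≤ (m : ℤ) → e n m = (c * qc q (1 / 2)) ^ m * f n) ∧
    (n ≤ -l₁ → -l₁ < n + (m : ℤ) → n + (m : ℤ) < l₁ → N ≤ (m : ℤ) →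
      e n m = qc q ((m : ℝ) / 2) * c ^ (-(m : ℤ)) * v (n + m)) ∧
    (n + (m : ℤ) ≤ -l₁ → e n m = (c ^ 2 * (q : ℂ)⁻¹) ^ n * (c * qc q (-(1 / 2))) ^ m * w)

theorem norm_qc {q : ℝ} (hq0 : 0 < q) (x : ℝ) : ‖qc q x‖ = q ^ x := by
  rw [qc, Complex.norm_real, Real.norm_of_nonneg (Real.rpow_nonneg hq0.le x)]

/-- A mean value estimate for `x ↦ q ^ x` on `[z, ∞)`. -/
theorem abs_rpow_sub_rpow_le {q : ℝ} (hq0 : 0 < q) (hq1 : q < 1) {x y z : ℝ}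
    (hx : z ≤ x) (hy : z ≤ y) :
    |q ^ x - q ^ y| ≤ -Real.log q * |x - y| * q ^ z := by
  wlog hxy : x ≤ y generalizing x y
  · rw [abs_sub_comm, abs_sub_comm x y]
    exact this hy hx (le_of_not_ge hxy)
  have hlog : Real.log q < 0 := Real.log_neg hq0 hq1
  have hsplit : q ^ y = q ^ x * q ^ (y - x) := by
    rw [← Real.rpow_add hq0]
    ring_nf
  have hexp : 1 + Real.log q * (y - x) ≤ q ^ (y - x) := by
    rw [Real.rpow_def_of_pos hq0]
    linarith [Real.add_one_le_exp (Real.log q * (y - x))]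
  have hanti : q ^ x ≤ q ^ z := Real.rpow_le_rpow_of_exponent_ge hq0 hq1.le hx
  have hle : q ^ y ≤ q ^ x := Real.rpow_le_rpow_of_exponent_ge hq0 hq1.le hxy
  rw [abs_of_nonneg (sub_nonneg.2 hle), abs_sub_comm, abs_of_nonneg (sub_nonneg.2 hxy)]
  calc q ^ x - q ^ y ≤ q ^ x * (-Real.log q * (y - x)) := by
        rw [hsplit]
        nlinarith [Real.rpow_pos_of_pos hq0 x]
    _ ≤ q ^ z * (-Real.log q * (y - x)) :=
        mul_le_mul_of_nonneg_right hanti (mul_nonneg (by linarith) (by linarith))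
    _ = -Real.log q * (y - x) * q ^ z := mul_comm _ _

theorem IsAdmissibleSeq.exists_norm_le {q : ℝ} (hq0 : 0 < q) {c : ℂ} (hc : ‖c‖ = 1) {l₁ : ℤ}
    {d : ℕ → ℂ} (hd : IsAdmissibleSeq q c l₁ d) :
    ∃ C : ℝ, 0 ≤ C ∧ ∀ m : ℕ, ‖d m‖ ≤ C * q ^ ((m : ℝ) / 2) := by
  obtain ⟨c₁, c₂, h⟩ := hd
  have hterm : ∀ i : ℕ, 0 ≤ ‖d i‖ / q ^ ((i : ℝ) / 2) := fun i =>
    div_nonneg (norm_nonneg _) (Real.rpow_nonneg hq0.le _)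
  have hsum : 0 ≤ ∑ i ∈ Finset.range l₁.toNat, ‖d i‖ / q ^ ((i : ℝ) / 2) :=
    Finset.sum_nonneg fun i _ => hterm i
  refine ⟨‖c₁‖ + ‖c₂‖ + ∑ i ∈ Finset.range l₁.toNat, ‖d i‖ / q ^ ((i : ℝ) / 2),
    by positivity, fun m => ?_⟩
  have hpos : 0 < q ^ ((m : ℝ) / 2) := Real.rpow_pos_of_pos hq0 _
  rw [← div_le_iff₀ hpos]
  by_cases hm : l₁ ≤ (m : ℤ)
  · rw [h m hm, norm_mul, norm_qc hq0, mul_div_cancel_left₀ _ hpos.ne']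
    have := norm_add_le (c₁ * c ^ (m : ℤ)) (c₂ * c ^ (-(m : ℤ)))
    simp only [norm_mul, norm_zpow, hc, one_zpow, mul_one] at this
    linarith
  · have := Finset.single_le_sum (fun i _ => hterm i)
      (Finset.mem_range.2 (by omega : m < l₁.toNat))
    linarith [norm_nonneg c₁, norm_nonneg c₂]

theorem IsAdmissibleFam.exists_norm_le {q : ℝ} (hq0 : 0 < q) (hq1 : q < 1) {l₁ : ℤ}
    (hl₁ : 0 < l₁) {b : ℤ → ℕ → ℂ} (hb : IsAdmissibleFam q l₁ b) :
    ∃ C : ℝ, 0 ≤ C ∧ ∀ (n : ℤ) (m : ℕ),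
      ‖b n m‖ ≤ C * q ^ ((max n 0 + max (-(n + (m : ℤ))) 0 - n : ℤ) : ℝ) := by
  obtain ⟨k₁, k₂, k₃, A, B, h⟩ := hb
  set I := Finset.Icc (-l₁) l₁
  set J := I ×ˢ Finset.range (2 * l₁).toNat
  have hA : ∀ n ∈ I, ‖A n‖ ≤ ∑ i ∈ I, ‖A i‖ := fun n hn =>
    Finset.single_le_sum (fun i _ => norm_nonneg (A i)) hn
  have hB : ∀ n ∈ I, ‖B n‖ ≤ ∑ i ∈ I, ‖B i‖ := fun n hn =>
    Finset.single_le_sum (fun i _ => norm_nonneg (B i)) hn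
  have hF : ∀ p ∈ J, ‖b p.1 p.2‖ ≤ ∑ i ∈ J, ‖b i.1 i.2‖ := fun p hp =>
    Finset.single_le_sum (fun i _ => norm_nonneg (b i.1 i.2)) hp
  have hA0 : 0 ≤ ∑ i ∈ I, ‖A i‖ := Finset.sum_nonneg fun i _ => norm_nonneg _
  have hB0 : 0 ≤ ∑ i ∈ I, ‖B i‖ := Finset.sum_nonneg fun i _ => norm_nonneg _
  have hF0 : 0 ≤ ∑ i ∈ J, ‖b i.1 i.2‖ := Finset.sum_nonneg fun i _ => norm_nonneg _
  set SA := ∑ i ∈ I, ‖A i‖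
  set SB := ∑ i ∈ I, ‖B i‖
  set SF := ∑ i ∈ J, ‖b i.1 i.2‖
  set K := ‖k₁‖ + ‖k₂‖ + ‖k₃‖ + SA + SB + SF
  have h1 := norm_nonneg k₁
  have h2 := norm_nonneg k₂
  have h3 := norm_nonneg k₃
  have hK0 : 0 ≤ K := by positivity
  refine ⟨K * q ^ ((-2 * l₁ : ℤ) : ℝ), mul_nonneg hK0 (Real.rpow_nonneg hq0.le _),
    fun n m => ?_⟩
  have key : ∀ (x : ℝ) (e : ℤ), x ≤ K →
      max n 0 + max (-(n + (m : ℤ))) 0 - n ≤ e + 2 * l₁ →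
      q ^ (e : ℝ) * x ≤ K * q ^ ((-2 * l₁ : ℤ) : ℝ) *
        q ^ ((max n 0 + max (-(n + (m : ℤ))) 0 - n : ℤ) : ℝ) := by
    intro x e hx he
    rw [mul_assoc, ← Real.rpow_add hq0, ← Int.cast_add, mul_comm]
    refine mul_le_mul hx (Real.rpow_le_rpow_of_exponent_ge hq0 hq1.le ?_)
      (Real.rpow_nonneg hq0.le _) hK0
    exact_mod_cast (by omega)
  obtain ⟨r1, r2, r3, r4, r5⟩ := h n m
  rcases le_or_gt l₁ n with hn | hn
  · simpa [r1 hn] using key ‖k₁‖ 0 (by linarith) (by omega)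
  rcases lt_or_ge (-l₁) n with hn' | hn'
  · rcases le_or_gt l₁ (n + m) with ha | ha
    · rw [r2 hn' hn ha]
      have := hA n (Finset.mem_Icc.2 ⟨hn'.le, hn.le⟩)
      simpa using key ‖A n‖ 0 (by linarith) (by omega)
    · have := hF (n, m) (Finset.mem_product.2
        ⟨Finset.mem_Icc.2 ⟨hn'.le, hn.le⟩, Finset.mem_range.2 (by dsimp only; omega)⟩)
      simpa using key ‖b n m‖ 0 (by linarith) (by omega)
  rcases le_or_gt l₁ (n + m) with ha | ha
  · rw [r3 hn' ha, norm_mul, norm_qc hq0]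
    have := key ‖k₂‖ (-n) (by linarith) (by omega)
    rwa [Int.cast_neg] at this
  rcases lt_or_ge (-l₁) (n + m) with ha' | ha'
  · rw [r4 hn' ha' ha, norm_mul, norm_qc hq0]
    have hBa := hB (n + m) (Finset.mem_Icc.2 ⟨ha'.le, ha.le⟩)
    have := key ‖B (n + m)‖ (-n) (by linarith) (by omega)
    rwa [Int.cast_neg] at this
  · rw [r5 ha', norm_mul, norm_qc hq0]
    have := key ‖k₃‖ (-(2 * n + m)) (by linarith) (by omega)
    push_cast at this ⊢
    exact this

/-- The difference of the two powers vanishes for `n ≤ 0` and `l ≤ n + m`; elsewhere the weight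
decays in `n` or in `n + m`, up to a power of `q` that depends on `l` only. -/
theorem rpow_mul_abs_rpow_sub_le {q : ℝ} (hq0 : 0 < q) (hq1 : q < 1) {s : ℝ} (hs : 0 < s)
    (n : ℤ) (m : ℕ) {l : ℤ} (hl : 0 < l) :
    q ^ ((max n 0 + max (-(n + (m : ℤ))) 0 : ℤ) : ℝ) *
        |q ^ (s * ((|n + (m : ℤ) - l| + |n - l| : ℤ) : ℝ)) -
          q ^ (s * ((|n + (m : ℤ)| + |n| : ℤ) : ℝ))| ≤
      (q ^ (((|n| : ℤ) : ℝ) / 4) + q ^ (((|n + (m : ℤ)| : ℤ) : ℝ) / 4)) *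
        q ^ (-(l : ℝ) / 4) * (-Real.log q * (s * (2 * l)) * q ^ (s * m)) := by
  have hlog : Real.log q < 0 := Real.log_neg hq0 hq1
  have hlR : (0 : ℝ) < l := by exact_mod_cast hl
  have hp : ∀ x : ℝ, 0 < q ^ x := fun x => Real.rpow_pos_of_pos hq0 x
  have hR : 0 ≤ -Real.log q * (s * (2 * l)) * q ^ (s * m) :=
    mul_nonneg (mul_nonneg (by linarith) (by positivity)) (hp _).le
  by_cases hz : n ≤ 0 ∧ l ≤ n + m
  · have he : |n + (m : ℤ) - l| + |n - l| = |n + (m : ℤ)| + |n| := by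
      obtain ⟨h1, h2⟩ := hz
      simp only [abs_eq_max_neg]
      omega
    rw [he, sub_self, abs_zero, mul_zero]
    exact mul_nonneg (mul_nonneg (add_pos (hp _) (hp _)).le (hp _).le) hR
  refine mul_le_mul ?_ ?_ (abs_nonneg _)
    (mul_nonneg (add_pos (hp _) (hp _)).le (hp _).le)
  · rw [add_mul, ← Real.rpow_add hq0, ← Real.rpow_add hq0]
    by_cases hn : 0 < n
    · refine le_add_of_le_of_nonneg (Real.rpow_le_rpow_of_exponent_ge hq0 hq1.le ?_) (hp _).le
      have : |n| - l ≤ 4 * (max n 0 + max (-(n + (m : ℤ))) 0) := by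
        simp only [abs_eq_max_neg]
        omega
      have : ((|n| : ℤ) : ℝ) - l ≤ 4 * ((max n 0 + max (-(n + (m : ℤ))) 0 : ℤ) : ℝ) := by
        exact_mod_cast this
      linarith
    · refine le_add_of_nonneg_of_le (hp _).le (Real.rpow_le_rpow_of_exponent_ge hq0 hq1.le ?_)
      have : |n + (m : ℤ)| - l ≤ 4 * (max n 0 + max (-(n + (m : ℤ))) 0) := by
        simp only [abs_eq_max_neg]
        omega
      have : ((|n + (m : ℤ)| : ℤ) : ℝ) - l ≤
          4 * ((max n 0 + max (-(n + (m : ℤ))) 0 : ℤ) : ℝ) := by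
        exact_mod_cast this
      linarith
  · have hX : (m : ℤ) ≤ |n + (m : ℤ) - l| + |n - l| := by
      simp only [abs_eq_max_neg]
      omega
    have hY : (m : ℤ) ≤ |n + (m : ℤ)| + |n| := by
      simp only [abs_eq_max_neg]
      omega
    have hXY : |(|n + (m : ℤ) - l| + |n - l|) - (|n + (m : ℤ)| + |n|)| ≤ 2 * l := by
      simp only [abs_eq_max_neg]
      omega
    generalize |n + (m : ℤ) - l| + |n - l| = X at hX hXY ⊢
    generalize |n + (m : ℤ)| + |n| = Y at hY hXY ⊢
    have hX' : (m : ℝ) ≤ X := by exact_mod_cast hX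
    have hY' : (m : ℝ) ≤ Y := by exact_mod_cast hY
    have hXY' : |(X : ℝ) - Y| ≤ 2 * l := by exact_mod_cast hXY
    refine (abs_rpow_sub_rpow_le hq0 hq1 (mul_le_mul_of_nonneg_left hX' hs.le)
      (mul_le_mul_of_nonneg_left hY' hs.le)).trans ?_
    rw [← mul_sub, abs_mul, abs_of_pos hs]
    have : 0 < -Real.log q := by linarith
    have := hp (s * m)
    gcongr

theorem summable_rpow_abs_div_four {q : ℝ} (hq0 : 0 < q) (hq1 : q < 1) :
    Summable fun n : ℤ => q ^ (((|n| : ℤ) : ℝ) / 4) := by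
  have hr : Summable fun k : ℕ => (q ^ (1 / 4 : ℝ)) ^ k :=
    summable_geometric_of_lt_one (Real.rpow_nonneg hq0.le _)
      (Real.rpow_lt_one hq0.le hq1 (by norm_num))
  have he : ∀ k : ℕ, (q ^ (1 / 4 : ℝ)) ^ k = q ^ ((k : ℝ) / 4) := fun k => by
    rw [← Real.rpow_mul_natCast hq0.le]
    ring_nf
  simp only [he] at hr
  refine Summable.of_nat_of_neg ?_ ?_ <;> simpa using hr

theorem summable_mul_rpow_div_four {q : ℝ} (hq0 : 0 < q) (hq1 : q < 1) (a : ℝ) :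
    Summable fun j : ℕ => (a + j) * q ^ ((a + j) / 4) := by
  set r := q ^ (1 / 4 : ℝ) with hr
  have hr0 : 0 ≤ r := Real.rpow_nonneg hq0.le _
  have hr1 : r < 1 := Real.rpow_lt_one hq0.le hq1 (by norm_num)
  have he : ∀ j : ℕ, (a + j) * q ^ ((a + j) / 4) =
      q ^ (a / 4) * a * r ^ j + q ^ (a / 4) * ((j : ℝ) ^ 1 * r ^ j) := fun j => by
    rw [hr, ← Real.rpow_mul_natCast hq0.le, add_div, Real.rpow_add hq0]
    ring_nf
  have h1 : Summable fun j : ℕ => r ^ j := summable_geometric_of_lt_one hr0 hr1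
  have h2 : Summable fun j : ℕ => (j : ℝ) ^ 1 * r ^ j :=
    summable_pow_mul_geometric_of_norm_lt_one 1 (by rwa [Real.norm_of_nonneg hr0])
  exact ((h1.mul_left _).add (h2.mul_left _)).congr fun j => (he j).symm

theorem hasSum_mul_add_shift {u : ℕ → ℝ} {v : ℤ → ℝ} {h : ℕ → ℝ} {U V H : ℝ}
    (hu : HasSum u U) (hv : HasSum v V) (hh : HasSum h H)
    (hu0 : 0 ≤ u) (hv0 : 0 ≤ v) (hh0 : 0 ≤ h) :
    HasSum (fun p : ℤ × ℕ × ℕ => (v p.1 + v (p.1 + p.2.1)) * u p.2.1 * h p.2.2)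
      (2 * V * U * H) := by
  have h1 : HasSum (fun p : ℤ × ℕ => v p.1 * u p.2) (V * U) :=
    hv.mul hu (hv.summable.mul_of_nonneg hu.summable hv0 hu0)
  let e : ℤ × ℕ ≃ ℤ × ℕ :=
    { toFun := fun p => (p.1 + p.2, p.2)
      invFun := fun p => (p.1 - p.2, p.2)
      left_inv := fun p => by simp
      right_inv := fun p => by simp }
  have h2 : HasSum (fun p : ℤ × ℕ => v (p.1 + p.2) * u p.2) (V * U) := e.hasSum_iff.2 h1
  have h3 := h1.add h2
  have h4 := h3.mul hh (h3.summable.mul_of_nonneg hh.summable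
    (fun p => add_nonneg (mul_nonneg (hv0 _) (hu0 _)) (mul_nonneg (hv0 _) (hu0 _))) hh0)
  have h5 := (Equiv.prodAssoc ℤ ℕ ℕ).symm.hasSum_iff.2 h4
  have hval : 2 * V * U * H = (V * U + V * U) * H := by ring
  rw [hval]
  refine h5.congr_fun fun p => ?_
  simp [add_mul]

theorem tendsto_sq_mul_tsum_rpow {q : ℝ} (hq0 : 0 < q) (hq1 : q < 1) :
    Tendsto (fun s : ℝ => s ^ 2 * ∑' m : ℕ, q ^ (s * m)) (𝓝[>] 0) (𝓝 0) := by
  have hlog : 0 < -Real.log q := by linarith [Real.log_neg hq0 hq1]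
  set L := -Real.log q with hL
  have hlim : Tendsto (fun s : ℝ => s * (1 + L * s) / L) (𝓝[>] 0) (𝓝 0) := by
    have hcont : Continuous fun s : ℝ => s * (1 + L * s) / L := by fun_prop
    have := (hcont.tendsto 0).mono_left (nhdsWithin_le_nhds (s := Set.Ioi 0))
    simpa using this
  refine squeeze_zero' ?_ ?_ hlim
  · exact Eventually.of_forall fun s => mul_nonneg (sq_nonneg s)
      (tsum_nonneg fun m => Real.rpow_nonneg hq0.le _)
  filter_upwards [self_mem_nhdsWithin] with s (hs : 0 < s)
  have hq : 0 < q ^ s := Real.rpow_pos_of_pos hq0 s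
  have hq' : q ^ s < 1 := Real.rpow_lt_one hq0.le hq1 hs
  have hsum : ∑' m : ℕ, q ^ (s * m) = (1 - q ^ s)⁻¹ := by
    simp only [Real.rpow_mul_natCast hq0.le]
    exact tsum_geometric_of_lt_one hq.le hq'
  have hpos : 0 < 1 - q ^ s := sub_pos.2 hq'
  have hexp : (1 + L * s) * q ^ s ≤ 1 := by
    have h1 : 1 + L * s ≤ q ^ (-s) := by
      rw [Real.rpow_def_of_pos hq0, hL]
      linarith [Real.add_one_le_exp (Real.log q * -s)]
    calc (1 + L * s) * q ^ s ≤ q ^ (-s) * q ^ s := by gcongr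
      _ = 1 := by rw [← Real.rpow_add hq0]; simp
  rw [hsum, ← div_eq_mul_inv, div_le_div_iff₀ hpos hlog]
  nlinarith

/-- claim (3) in the proof of Lemma 5.1, with `l = l₁ + j`, `j : ℕ`. -/
theorem stmt3 (q : ℝ) (hq0 : 0 < q) (hq1 : q < 1) (c α : ℂ)
    (hc : ‖c‖ = 1) (hα : ‖α‖ = 1) (l₁ : ℤ) (hl₁ : 0 < l₁)
    (d : ℕ → ℂ) (hd : IsAdmissibleSeq q c l₁ d)
    (b : ℤ → ℕ → ℂ) (hb : IsAdmissibleFam q l₁ b)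
    (T : ℝ → ℤ × ℕ × ℕ → ℂ)
    (hT : ∀ (s : ℝ) (n : ℤ) (m j : ℕ),
      T s (n, m, j) = c ^ (2 * n + (m : ℤ)) * qc q ((n : ℝ) - (m : ℝ) / 2) * d m * b n m *
        (c⁻¹ * α⁻¹) ^ (l₁ + (j : ℤ)) * qc q (((l₁ : ℝ) + (j : ℝ)) / 2) *
        (qc q (s * (((|n + (m : ℤ) - (l₁ + (j : ℤ))| : ℤ) : ℝ) +
            ((|n - (l₁ + (j : ℤ))| : ℤ) : ℝ))) -
         qc q (s * (((|n + (m : ℤ)| : ℤ) : ℝ) + ((|n| : ℤ) : ℝ))))) :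
    (∀ s : ℝ, 0 < s → Summable fun p : ℤ × ℕ × ℕ => ‖T s p‖) ∧
    Tendsto (fun s : ℝ => (s : ℂ) * ∑' p : ℤ × ℕ × ℕ, T s p)
      (𝓝[>] (0 : ℝ)) (𝓝 0) := by
  obtain ⟨Cd, hCd0, hCd⟩ := hd.exists_norm_le hq0 hc
  obtain ⟨Cb, hCb0, hCb⟩ := hb.exists_norm_le hq0 hq1 hl₁
  have hlog : 0 < -Real.log q := by linarith [Real.log_neg hq0 hq1]
  have hp : ∀ x : ℝ, 0 < q ^ x := fun x => Real.rpow_pos_of_pos hq0 x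
  set v : ℤ → ℝ := fun n => q ^ (((|n| : ℤ) : ℝ) / 4)
  set h : ℕ → ℝ := fun j => ((l₁ : ℝ) + j) * q ^ (((l₁ : ℝ) + j) / 4) with hh
  set C : ℝ := Cd * Cb * (-Real.log q * 2) with hC
  have hbound : ∀ s : ℝ, 0 < s → ∀ p : ℤ × ℕ × ℕ, ‖T s p‖ ≤
      C * s * ((v p.1 + v (p.1 + p.2.1)) * q ^ (s * p.2.1) * h p.2.2) := by
    rintro s hs ⟨n, m, j⟩
    have hmain := rpow_mul_abs_rpow_sub_le hq0 hq1 hs n m (l := l₁ + j) (by omega)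
    set D := |q ^ (s * ((|n + (m : ℤ) - (l₁ + j)| + |n - (l₁ + j)| : ℤ) : ℝ)) -
          q ^ (s * ((|n + (m : ℤ)| + |n| : ℤ) : ℝ))| with hD
    have hT' : ‖T s (n, m, j)‖ =
        q ^ ((n : ℝ) - m / 2) * ‖d m‖ * ‖b n m‖ * q ^ (((l₁ : ℝ) + j) / 2) * D := by
      have hDn : ‖qc q (s * (((|n + (m : ℤ) - (l₁ + (j : ℤ))| : ℤ) : ℝ) +
            ((|n - (l₁ + (j : ℤ))| : ℤ) : ℝ))) -
         qc q (s * (((|n + (m : ℤ)| : ℤ) : ℝ) + ((|n| : ℤ) : ℝ)))‖ = D := by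
        rw [qc, qc, ← Complex.ofReal_sub, Complex.norm_real, Real.norm_eq_abs, hD,
          Int.cast_add, Int.cast_add]
      rw [hT, norm_mul, hDn]
      simp [norm_qc hq0, hc, hα]
    have hcoef : q ^ ((n : ℝ) - m / 2) * ‖d m‖ * ‖b n m‖ ≤
        Cd * Cb * q ^ ((max n 0 + max (-(n + (m : ℤ))) 0 : ℤ) : ℝ) := by
      calc q ^ ((n : ℝ) - m / 2) * ‖d m‖ * ‖b n m‖ ≤
          q ^ ((n : ℝ) - m / 2) * (Cd * q ^ ((m : ℝ) / 2)) *
            (Cb * q ^ ((max n 0 + max (-(n + (m : ℤ))) 0 - n : ℤ) : ℝ)) :=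
            mul_le_mul (mul_le_mul_of_nonneg_left (hCd m) (hp _).le) (hCb n m)
              (norm_nonneg _) (mul_nonneg (hp _).le (mul_nonneg hCd0 (hp _).le))
        _ = Cd * Cb * (q ^ ((n : ℝ) - m / 2) * q ^ ((m : ℝ) / 2) *
            q ^ ((max n 0 + max (-(n + (m : ℤ))) 0 - n : ℤ) : ℝ)) := by ring
        _ = _ := by
            rw [← Real.rpow_add hq0, ← Real.rpow_add hq0, Int.cast_sub]
            ring_nf
    have hD0 : 0 ≤ D := abs_nonneg _
    have hhalf : q ^ (-(((l₁ + j : ℤ)) : ℝ) / 4) * q ^ (((l₁ : ℝ) + j) / 2) =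
        q ^ (((l₁ : ℝ) + j) / 4) := by
      rw [← Real.rpow_add hq0]
      push_cast
      ring_nf
    rw [hT']
    calc q ^ ((n : ℝ) - m / 2) * ‖d m‖ * ‖b n m‖ * q ^ (((l₁ : ℝ) + j) / 2) * D
        ≤ Cd * Cb * q ^ ((max n 0 + max (-(n + (m : ℤ))) 0 : ℤ) : ℝ) *
            q ^ (((l₁ : ℝ) + j) / 2) * D :=
          mul_le_mul_of_nonneg_right (mul_le_mul_of_nonneg_right hcoef (hp _).le) hD0
      _ = Cd * Cb * q ^ (((l₁ : ℝ) + j) / 2) *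
            (q ^ ((max n 0 + max (-(n + (m : ℤ))) 0 : ℤ) : ℝ) * D) := by ring
      _ ≤ _ := mul_le_mul_of_nonneg_left hmain
          (mul_nonneg (mul_nonneg hCd0 hCb0) (hp _).le)
      _ = Cd * Cb * (v n + v (n + m)) * (-Real.log q * (s * (2 * ((l₁ + j : ℤ) : ℝ))) *
            q ^ (s * m)) * (q ^ (-(((l₁ + j : ℤ)) : ℝ) / 4) * q ^ (((l₁ : ℝ) + j) / 2)) := by
          ring
      _ = _ := by
          rw [hhalf, hC, hh]
          push_cast
          ring
  have hsum : ∀ s : ℝ, 0 < s → HasSum (fun p : ℤ × ℕ × ℕ =>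
      C * s * ((v p.1 + v (p.1 + p.2.1)) * q ^ (s * p.2.1) * h p.2.2))
      (C * s * (2 * (∑' n, v n) * (∑' m : ℕ, q ^ (s * m)) * ∑' j, h j)) := by
    intro s hs
    have hu : Summable fun m : ℕ => q ^ (s * m) := by
      simp only [Real.rpow_mul_natCast hq0.le]
      exact summable_geometric_of_lt_one (hp s).le (Real.rpow_lt_one hq0.le hq1 hs)
    have hl₁' : (0 : ℝ) < l₁ := by exact_mod_cast hl₁
    exact (hasSum_mul_add_shift hu.hasSum (summable_rpow_abs_div_four hq0 hq1).hasSum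
      (summable_mul_rpow_div_four hq0 hq1 l₁).hasSum (fun m => (hp _).le) (fun n => (hp _).le)
      (fun j => mul_nonneg (by positivity) (hp _).le)).mul_left _
  refine ⟨fun s hs => Summable.of_nonneg_of_le (fun p => norm_nonneg _) (hbound s hs)
    (hsum s hs).summable, ?_⟩
  have hlim := (tendsto_sq_mul_tsum_rpow hq0 hq1).const_mul (C * 2 * (∑' n, v n) * ∑' j, h j)
  rw [mul_zero] at hlim
  refine squeeze_zero_norm' ?_ hlim
  filter_upwards [self_mem_nhdsWithin] with s (hs : 0 < s)
  rw [norm_mul, Complex.norm_real, Real.norm_of_nonneg hs.le]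
  calc s * ‖∑' p, T s p‖
      ≤ s * (C * s * (2 * (∑' n, v n) * (∑' m : ℕ, q ^ (s * m)) * ∑' j, h j)) :=
        mul_le_mul_of_nonneg_left (tsum_of_norm_bounded (hsum s hs) (hbound s hs)) hs.le
    _ = _ := by ring
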